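/- arXiv:2110.08158 — 4 statements merged into one kernel-verified Lean document; each statement's English description precedes it below -/
import Mathlib

section
/- Let n ≥ 5 and let S be the n×n matrix over the multivariate polynomial ring ℚ[x_{ij} : i, j ∈ Fin n] whose (i,j) entry is 0 if j = i or j = i+1 (indices mod n), and is the variable x_{ij} otherwise. Then the number of pairs (R, C), where R and C are 4-element subsets of Fin n, such that the determinant of the 4×4 submatrix of S with rows R and columns C (taken with order-preserving enumerations) is a trinomial — that is, a polynomial whose support consists of exactly 3 monomials — is exactly 2n. -/
theorem bool_matrix_permanent_eq_three :
    ∀ a0 a1 a2 a3 : Bool, a0.toNat + a1.toNat + a2.toNat + a3.toNat ≤ 2 →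
    ∀ b0 b1 b2 b3 : Bool, b0.toNat + b1.toNat + b2.toNat + b3.toNat ≤ 2 →
    ∀ c0 c1 c2 c3 : Bool, c0.toNat + c1.toNat + c2.toNat + c3.toNat ≤ 2 →
      a0.toNat + b0.toNat + c0.toNat ≤ 2 → a1.toNat + b1.toNat + c1.toNat ≤ 2 →
      a2.toNat + b2.toNat + c2.toNat ≤ 2 → a3.toNat + b3.toNat + c3.toNat ≤ 2 →
    ∀ d0 d1 d2 d3 : Bool, d0.toNat + d1.toNat + d2.toNat + d3.toNat ≤ 2 →
      a0.toNat + b0.toNat + c0.toNat + d0.toNat ≤ 2 → a1.toNat + b1.toNat + c1.toNat + d1.toNat ≤ 2 →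
      a2.toNat + b2.toNat + c2.toNat + d2.toNat ≤ 2 → a3.toNat + b3.toNat + c3.toNat + d3.toNat ≤ 2 →
    ((!a0 && !b1).toNat + (!a1 && !b0).toNat) * ((!c2 && !d3).toNat + (!c3 && !d2).toNat) +
    ((!a0 && !b2).toNat + (!a2 && !b0).toNat) * ((!c1 && !d3).toNat + (!c3 && !d1).toNat) +
    ((!a0 && !b3).toNat + (!a3 && !b0).toNat) * ((!c1 && !d2).toNat + (!c2 && !d1).toNat) +
    ((!a1 && !b2).toNat + (!a2 && !b1).toNat) * ((!c0 && !d3).toNat + (!c3 && !d0).toNat) +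
    ((!a1 && !b3).toNat + (!a3 && !b1).toNat) * ((!c0 && !d2).toNat + (!c2 && !d0).toNat) +
    ((!a2 && !b3).toNat + (!a3 && !b2).toNat) * ((!c0 && !d1).toNat + (!c1 && !d0).toNat) = 3 →
    (a0.toNat + a1.toNat + a2.toNat + a3.toNat) + (b0.toNat + b1.toNat + b2.toNat + b3.toNat) +
    (c0.toNat + c1.toNat + c2.toNat + c3.toNat) + (d0.toNat + d1.toNat + d2.toNat + d3.toNat) = 7 := by
  decide +kernel

theorem sum_perm_succ {n : ℕ} {M : Type*} [AddCommMonoid M] (f : Equiv.Perm (Fin (n + 1)) → M) :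
    ∑ σ, f σ = ∑ p, ∑ τ, f (Equiv.Perm.decomposeFin.symm (p, τ)) := by
  rw [← Fintype.sum_prod_type', ← Equiv.sum_comp Equiv.Perm.decomposeFin.symm]

theorem sum_perm_fin_four (f : Fin 4 → Fin 4 → ℕ) : ∑ σ : Equiv.Perm (Fin 4), ∏ i, f i (σ i) =
    (f 0 0 * f 1 1 + f 0 1 * f 1 0) * (f 2 2 * f 3 3 + f 2 3 * f 3 2) +
    (f 0 0 * f 1 2 + f 0 2 * f 1 0) * (f 2 1 * f 3 3 + f 2 3 * f 3 1) +
    (f 0 0 * f 1 3 + f 0 3 * f 1 0) * (f 2 1 * f 3 2 + f 2 2 * f 3 1) +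
    (f 0 1 * f 1 2 + f 0 2 * f 1 1) * (f 2 0 * f 3 3 + f 2 3 * f 3 0) +
    (f 0 1 * f 1 3 + f 0 3 * f 1 1) * (f 2 0 * f 3 2 + f 2 2 * f 3 0) +
    (f 0 2 * f 1 3 + f 0 3 * f 1 2) * (f 2 0 * f 3 1 + f 2 1 * f 3 0) := by
  simp only [sum_perm_succ, Fin.sum_univ_succ, Fin.prod_univ_succ, Equiv.Perm.decomposeFin_symm_apply_succ, Equiv.Perm.decomposeFin_symm_apply_zero]
  simp [Equiv.swap_apply_def]
  ring
theorem eq_of_card_filter_sub_mem {G : Type*} [AddCommGroup G] [DecidableEq G] (u : G) (R : Finset G)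
    (hgen : ∀ x : G, ∃ k : ℕ, x = k • u) (hR : R.card = 4)
    (h : (R.filter (fun x => x - u ∈ R)).card = 3) :
    ∃ i, R = {i, i + u, i + u + u, i + u + u + u} := by
  have h1 : (R.filter (fun x => ¬ x - u ∈ R)).card = 1 := by
    have := Finset.card_filter_add_card_filter_not (s := R) (fun x => x - u ∈ R)
    omega
  obtain ⟨i, hi⟩ := Finset.card_eq_one.1 h1
  have hpred : ∀ x ∈ R, x ≠ i → x - u ∈ R := by
    intro x hx hxi
    by_contra hc
    have : x ∈ R.filter (fun x => ¬ x - u ∈ R) := by simp [hx, hc]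
    rw [hi] at this
    exact hxi (by simpa using this)
  have hsub : R ⊆ {i, i + u, i + u + u, i + u + u + u} := by
    intro x hx
    have hex : ∃ k : ℕ, x = i + k • u := by
      obtain ⟨k, hk⟩ := hgen (x - i)
      exact ⟨k, by rw [← hk]; abel⟩
    classical
    obtain ⟨k, hk, hmin⟩ : ∃ k : ℕ, x = i + k • u ∧ ∀ j < k, x ≠ i + j • u :=
      ⟨Nat.find hex, Nat.find_spec hex, fun j hj => Nat.find_min hex hj⟩
    have hmem : ∀ j ≤ k, x - j • u ∈ R := by
      intro j
      induction j with
      | zero => simpa using hx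
      | succ j ih =>
        intro hj
        have := hpred _ (ih (by omega)) (fun hc => hmin j (by omega) (by rw [← hc]; abel))
        rwa [sub_sub, ← succ_nsmul] at this
    have hinj : Set.InjOn (fun j : ℕ => x - j • u) (Finset.range (k + 1)) := by
      have key : ∀ a b : ℕ, a < b → b ≤ k → x - a • u ≠ x - b • u := by
        intro a b hab hbk hc
        apply hmin (k - (b - a)) (by omega)
        have e : b • u = a • u + (b - a) • u := by rw [← add_nsmul]; congr 1; omega
        have e2 : k • u = (k - (b - a)) • u + (b - a) • u := by rw [← add_nsmul]; congr 1; omega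
        have e3 : (b - a) • u = 0 := by
          rw [sub_right_inj, e] at hc
          simpa using hc
        rw [hk, e2, e3, add_zero]
      intro a ha b hb hab
      simp only [Finset.coe_range, Set.mem_Iio] at ha hb
      rcases lt_trichotomy a b with hl | hl | hl
      · exact absurd hab (key a b hl (by omega))
      · exact hl
      · exact absurd hab.symm (key b a hl (by omega))
    have hc : k + 1 ≤ 4 := by
      rw [← hR, ← Finset.card_range (k + 1)]
      exact Finset.card_le_card_of_injOn _ (fun j hj => hmem j (by simpa [Nat.lt_succ_iff] using hj)) hinj
    have : k < 4 := by omega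
    interval_cases k <;> simp [hk, succ_nsmul, add_assoc]
  refine ⟨i, Finset.eq_of_subset_of_card_le hsub ?_⟩
  rw [hR]
  exact Finset.card_le_four

theorem support_sum_monomial {ι σ R : Type*} [DecidableEq ι] [CommSemiring R] (s : Finset ι)
    (m : ι → σ →₀ ℕ) (hm : Function.Injective m) (a : ι → R) (ha : ∀ i, a i ≠ 0) :
    (∑ i ∈ s, MvPolynomial.monomial (m i) (a i)).support = s.map ⟨m, hm⟩ := by
  classical
  ext d
  simp only [MvPolynomial.mem_support_iff, MvPolynomial.coeff_sum, MvPolynomial.coeff_monomial,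
    Finset.mem_map, Function.Embedding.coeFn_mk]
  constructor
  · intro h
    obtain ⟨i, hi, h⟩ := Finset.exists_ne_zero_of_sum_ne_zero h
    exact ⟨i, hi, by by_contra hc; simp [hc] at h⟩
  · rintro ⟨i, hi, rfl⟩
    simp [hm.eq_iff, hi, ha]

/-- The determinant of a matrix whose entries are zeros and distinct variables has one monomial for
each permutation avoiding the zeros. -/
theorem card_support_det {ι κ κ' : Type*} [Fintype ι] [DecidableEq ι]  (r : ι → κ) (c : ι → κ')
    (hr : Function.Injective r) (hc : Function.Injective c) (Z : ι → ι → Prop) [∀ i j, Decidable (Z i j)]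
    (M : Matrix ι ι (MvPolynomial (κ × κ') ℚ))
    (hM : ∀ i j, M i j = if Z i j then 0 else MvPolynomial.X (r i, c j)) :
    M.det.support.card = (Finset.univ.filter fun σ : Equiv.Perm ι => ∀ i, ¬ Z (σ i) i).card := by
  classical
  let m : Equiv.Perm ι → (κ × κ') →₀ ℕ := fun σ => ∑ i, Finsupp.single (r (σ i), c i) 1
  have hm : Function.Injective m := by
    intro σ τ h
    ext i
    have h2 : m τ (r (σ i), c i) ≠ 0 := by
      rw [← h]
      simp only [m, Finsupp.finsetSum_apply]
      intro h0
      have := Finset.sum_eq_zero_iff.1 h0 i (Finset.mem_univ _)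
      simp at this
    simp only [m, Finsupp.finsetSum_apply] at h2
    obtain ⟨k, -, hk⟩ := Finset.exists_ne_zero_of_sum_ne_zero h2
    rw [Finsupp.single_apply, ite_ne_right_iff, Prod.mk.injEq] at hk
    obtain ⟨⟨h3, h4⟩, -⟩ := hk
    obtain rfl := hc h4
    exact (hr h3).symm
  have hdet : M.det = ∑ σ ∈ Finset.univ.filter (fun σ : Equiv.Perm ι => ∀ i, ¬ Z (σ i) i),
      MvPolynomial.monomial (m σ) (((Equiv.Perm.sign σ : ℤ) : ℚ)) := by
    rw [Matrix.det_apply', Finset.sum_filter]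
    refine Finset.sum_congr rfl fun σ _ => ?_
    split_ifs with h
    · have : ∏ i, M (σ i) i = MvPolynomial.monomial (m σ) 1 := by
        simp only [m, MvPolynomial.monomial_sum_one]
        exact Finset.prod_congr rfl fun i _ => by rw [hM, if_neg (h i)]; rfl
      rw [this, ← map_intCast (MvPolynomial.C (σ := κ × κ') (R := ℚ)), MvPolynomial.C_mul_monomial, mul_one]
    · push Not at h
      obtain ⟨i, hi⟩ := h
      rw [Finset.prod_eq_zero (Finset.mem_univ i) (by rw [hM, if_pos hi]), mul_zero]
  rw [hdet, support_sum_monomial _ _ hm _ (fun σ => by simp), Finset.card_map]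

theorem card_perm_reindex {ι : Type*} [Fintype ι] [DecidableEq ι] (Z : ι → ι → Prop)
    [∀ i j, Decidable (Z i j)] (α β : Equiv.Perm ι) :
    (Finset.univ.filter fun σ : Equiv.Perm ι => ∀ i, ¬ Z (α (σ i)) (β i)).card =
      (Finset.univ.filter fun σ : Equiv.Perm ι => ∀ i, ¬ Z (σ i) i).card := by
  refine Finset.card_equiv (Equiv.equivCongr β α) fun σ => ?_
  simp only [Finset.mem_filter, Finset.mem_univ, true_and]
  rw [← β.forall_congr_right (q := fun i => ¬ Z ((Equiv.equivCongr β α) σ i) i)]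
  simp [Equiv.equivCongr]

theorem orderIsoOfFin_factor {κ : Type*} [LinearOrder κ] {m : ℕ} {R : Finset κ} (hR : R.card = m)
    (r : Fin m → κ) (hr : Function.Injective r) (hrR : ∀ k, r k ∈ R) :
    ∃ α : Equiv.Perm (Fin m), ∀ k, ((R.orderIsoOfFin hR (α k) : R) : κ) = r k := by
  have hinj : Function.Injective fun k => (R.orderIsoOfFin hR).symm ⟨r k, hrR k⟩ := by
    intro a b hab
    exact hr (by simpa using hab)
  exact ⟨Equiv.ofBijective _ (Finite.injective_iff_bijective.1 hinj), fun k => by simp⟩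

theorem sum_orderIsoOfFin {κ M : Type*} [LinearOrder κ] [AddCommMonoid M] {m : ℕ} {R : Finset κ}
    (hR : R.card = m) (g : κ → M) :
    ∑ a, g (R.orderIsoOfFin hR a : R) = ∑ x ∈ R, g x := by
  rw [← Finset.sum_coe_sort R g]
  exact Equiv.sum_comp (R.orderIsoOfFin hR).toEquiv fun x : R => g x

/-- A `4 × 4` zero pattern with at most two zeros in each row and column that is avoided by
exactly three permutations has exactly seven zeros. -/
theorem sum_eq_seven_of_card_perm_eq_three (Z : Fin 4 → Fin 4 → Bool)
    (hrow : ∀ a, ∑ b, (Z a b).toNat ≤ 2) (hcol : ∀ b, ∑ a, (Z a b).toNat ≤ 2)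
    (h : (Finset.univ.filter fun σ : Equiv.Perm (Fin 4) => ∀ i, ¬ Z (σ i) i = true).card = 3) :
    ∑ a, ∑ b, (Z a b).toNat = 7 := by
  have key : (Finset.univ.filter fun σ : Equiv.Perm (Fin 4) => ∀ i, ¬ Z (σ i) i = true).card =
      ∑ σ : Equiv.Perm (Fin 4), ∏ i, (! Z i (σ i)).toNat := by
    rw [Finset.card_filter, ← Equiv.sum_comp (Equiv.inv (Equiv.Perm (Fin 4)))]
    refine Finset.sum_congr rfl fun σ _ => ?_
    simp only [Equiv.inv_apply]
    have e : (∀ i, ¬ Z (σ⁻¹ i) i = true) ↔ ∀ i, ¬ Z i (σ i) = true := by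
      rw [← σ.forall_congr_right]
      simp
    simp only [e]
    split_ifs with hs
    · exact (Finset.prod_eq_one fun i _ => by simp [hs i]).symm
    · push Not at hs
      obtain ⟨i, hi⟩ := hs
      exact (Finset.prod_eq_zero (Finset.mem_univ i) (by simp [hi])).symm
  rw [key, sum_perm_fin_four fun a b => (! Z a b).toNat] at h
  have hb : ∀ p q r s : Bool, (!p).toNat * (!q).toNat + (!r).toNat * (!s).toNat =
      (!p && !q).toNat + (!r && !s).toNat := by decide
  simp only [hb] at h
  simp only [Fin.sum_univ_four] at hrow hcol ⊢
  have h0 := hcol 0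
  have h1 := hcol 1
  have h2 := hcol 2
  have h3 := hcol 3
  exact bool_matrix_permanent_eq_three _ _ _ _ (hrow 0) _ _ _ _ (hrow 1) _ _ _ _ (hrow 2) (by omega) (by omega)
    (by omega) (by omega) _ _ _ _ (hrow 3) h0 h1 h2 h3 h

/-- The four consecutive elements `i, i + u, i + 2u, i + 3u`. -/
def arc {G : Type*} [AddCommGroup G] [DecidableEq G] (u i : G) : Finset G :=
  {i, i + u, i + u + u, i + u + u + u}

/-- The enumeration of `arc u i` starting at `i`. -/
def arcVec {G : Type*} [AddCommGroup G] (u i : G) : Fin 4 → G :=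
  ![i, i + u, i + u + u, i + u + u + u]

theorem arcVec_mem {G : Type*} [AddCommGroup G] [DecidableEq G] (u i : G) (k : Fin 4) :
    arcVec u i k ∈ arc u i := by
  fin_cases k <;> simp [arcVec, arc]

theorem arcVec_injective {G : Type*} [AddCommGroup G] {u : G}
    (h3 : u + u + u ≠ 0) (h2 : u + u ≠ 0) (i : G) :
    Function.Injective (arcVec u i) := by
  intro a b
  fin_cases a <;> fin_cases b <;> simp [arcVec] <;> grind

theorem card_arc {G : Type*} [AddCommGroup G] [DecidableEq G] {u : G}
    (h3 : u + u + u ≠ 0) (h2 : u + u ≠ 0) (i : G) : (arc u i).card = 4 := by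
  have : arc u i = Finset.univ.map ⟨arcVec u i, arcVec_injective h3 h2 i⟩ := by
    ext x
    simp [arc, arcVec, Fin.exists_fin_succ, eq_comm]
  rw [this, Finset.card_map, Finset.card_univ, Fintype.card_fin]

theorem arc_injective {G : Type*} [AddCommGroup G] [DecidableEq G] {u : G}
    (h4 : u + u + u + u ≠ 0) (h3 : u + u + u ≠ 0) :
    Function.Injective (arc u) := by
  intro i j h
  have hi : i ∈ arc u j := by rw [← h]; simp [arc]
  have hn : i - u ∉ arc u j := by
    rw [← h]
    simp only [arc, Finset.mem_insert, Finset.mem_singleton]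
    grind
  simp only [arc, Finset.mem_insert, Finset.mem_singleton] at hi hn
  grind

theorem eq_arc_of_card_filter {G : Type*} [AddCommGroup G] [DecidableEq G] {u : G}
    (hgen : ∀ x : G, ∃ k : ℕ, x = k • u) {R C : Finset G} (hR : R.card = 4) (hC : C.card = 4)
    (h : (R.filter (fun x => x ∈ C)).card + (R.filter (fun x => x + u ∈ C)).card = 7) :
    ∃ i, R = arc u i ∧ (C = arc u i ∨ C = arc u (i + u)) := by
  have hle1 := Finset.card_filter_le R (fun x => x ∈ C)
  have hle2 := Finset.card_filter_le R (fun x => x + u ∈ C)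
  have hcases : (R.filter (fun x => x ∈ C)).card = 4 ∧ (R.filter (fun x => x + u ∈ C)).card = 3 ∨
    (R.filter (fun x => x ∈ C)).card = 3 ∧ (R.filter (fun x => x + u ∈ C)).card = 4 := by omega
  rcases hcases with ⟨h4, h3⟩ | ⟨h3, h4⟩
  · rw [← hR, Finset.card_filter_eq_iff] at h4
    obtain rfl : R = C := Finset.eq_of_subset_of_card_le h4 (by omega)
    obtain ⟨i, hi⟩ := eq_of_card_filter_sub_mem (-u) R (fun x => by
      obtain ⟨k, hk⟩ := hgen (-x)
      exact ⟨k, by rw [smul_neg, ← hk, neg_neg]⟩) hR (by simpa using h3)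
    have : R = arc u (i + -u + -u + -u) := by
      rw [hi]
      ext x
      simp only [arc, Finset.mem_insert, Finset.mem_singleton, neg_add_cancel_right]
      tauto
    exact ⟨_, this, Or.inl this⟩
  · rw [← hR, Finset.card_filter_eq_iff] at h4
    have hCR : R.map (addRightEmbedding u) = C := by
      refine Finset.eq_of_subset_of_card_le ?_ (by simp; omega)
      intro y hy
      obtain ⟨x, hx, rfl⟩ := Finset.mem_map.1 hy
      exact h4 x hx
    have hm : ∀ x, x ∈ C ↔ x - u ∈ R := by
      intro x
      simp [← hCR, ← eq_sub_iff_add_eq]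
    simp only [hm] at h3
    obtain ⟨i, hi⟩ := eq_of_card_filter_sub_mem u R hgen hR h3
    refine ⟨i, hi, Or.inr ?_⟩
    rw [← hCR, hi]
    simp [arc]

theorem sum_slack_row {G : Type*} [AddCommGroup G] [DecidableEq G] {u : G} (h1 : u ≠ 0)
    (C : Finset G) (x : G) : ∑ y ∈ C, (decide (y = x ∨ y = x + u)).toNat =
      (if x ∈ C then 1 else 0) + if x + u ∈ C then 1 else 0 := by
  have : ∀ y, (decide (y = x ∨ y = x + u)).toNat =
      (if y = x then 1 else 0) + if y = x + u then 1 else 0 := by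
    intro y
    by_cases hy : y = x
    · simp [hy, h1]
    · by_cases hz : y = x + u <;> simp [hy, hz, h1]
  simp only [this, Finset.sum_add_distrib, Finset.sum_ite_eq']

theorem sum_slack_col_le {G : Type*} [AddCommGroup G] [DecidableEq G] {u : G} (h1 : u ≠ 0)
    (R : Finset G) (y : G) : ∑ x ∈ R, (decide (y = x ∨ y = x + u)).toNat ≤ 2 := by
  have h := sum_slack_row (u := -u) (by simpa using h1) R y
  have e : ∀ x, (y = x ∨ y = x + u) ↔ (x = y ∨ x = y + -u) := by
    intro x
    rw [eq_comm, ← sub_eq_add_neg, eq_sub_iff_add_eq, eq_comm (a := x + u)]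
  simp only [e, h]
  split_ifs <;> simp

theorem card_perm_arc {G : Type*} [AddCommGroup G] [DecidableEq G] {u : G}
    (h4 : u + u + u + u ≠ 0) (h3 : u + u + u ≠ 0) (h1 : u ≠ 0) (i : G) (t : Bool) :
    (Finset.univ.filter fun σ : Equiv.Perm (Fin 4) => ∀ k,
      ¬ (arcVec u (if t then i + u else i) k = arcVec u i (σ k) ∨
        arcVec u (if t then i + u else i) k = arcVec u i (σ k) + u)).card = 3 := by
  cases t
  · have e : ∀ a b : Fin 4, (arcVec u i b = arcVec u i a ∨ arcVec u i b = arcVec u i a + u) ↔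
        (b = a ∨ b.val = a.val + 1) := by
      intro a b
      fin_cases a <;> fin_cases b <;> simp [arcVec] <;> grind
    simp only [Bool.false_eq_true, if_false, e]
    decide
  · have e : ∀ a b : Fin 4, (arcVec u (i + u) b = arcVec u i a ∨
        arcVec u (i + u) b = arcVec u i a + u) ↔ (a.val = b.val + 1 ∨ b = a) := by
      intro a b
      fin_cases a <;> fin_cases b <;> simp [arcVec] <;> grind
    simp only [if_true, e]
    decide

theorem Fin.val_nsmul_one {n : ℕ} [NeZero n] (k : ℕ) : (k • (1 : Fin n)).val = k % n := by
  induction k with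
  | zero => simp
  | succ k ih => rw [succ_nsmul, Fin.val_add, ih, Fin.val_one', Nat.add_mod_mod, Nat.mod_add_mod]


/-- **Proposition 3.1**: for an `n`-gon with `n ≥ 5`, exactly `2n` of the 4-minors of
the symbolic slack matrix are trinomials. The symbolic slack matrix `S` has entry `0`
at position `(i,j)` when `j = i` or `j = i + 1 (mod n)` and the variable `x_{ij}`
otherwise; a 4-minor is indexed by a pair of 4-element subsets of rows and columns,
taken with their order-preserving enumerations. -/
theorem stmt_5 (n : ℕ) (hn : 5 ≤ n)
    (S : Matrix (Fin n) (Fin n) (MvPolynomial (Fin n × Fin n) ℚ))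
    (hS : ∀ i j : Fin n,
      S i j = if (j : ℕ) = (i : ℕ) ∨ (j : ℕ) = ((i : ℕ) + 1) % n then 0
              else MvPolynomial.X (i, j)) :
    {p : Finset (Fin n) × Finset (Fin n) |
      ∃ (hR : p.1.card = 4) (hC : p.2.card = 4),
        ((S.submatrix (fun i => ((p.1.orderIsoOfFin hR) i : Fin n))
            (fun j => ((p.2.orderIsoOfFin hC) j : Fin n))).det).support.card = 3}.ncard
      = 2 * n := by
  have : NeZero n := ⟨by omega⟩
  have hne : ∀ k < n, k ≠ 0 → k • (1 : Fin n) ≠ 0 := by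
    intro k hk hk0 h
    have := Fin.val_nsmul_one (n := n) k
    rw [h, Nat.mod_eq_of_lt hk] at this
    exact hk0 (by simpa using this.symm)
  have h1 : (1 : Fin n) ≠ 0 := by simpa using hne 1 (by omega) (by omega)
  have h2 : (1 : Fin n) + 1 ≠ 0 := by simpa [succ_nsmul] using hne 2 (by omega) (by omega)
  have h3 : (1 : Fin n) + 1 + 1 ≠ 0 := by simpa [succ_nsmul] using hne 3 (by omega) (by omega)
  have h4 : (1 : Fin n) + 1 + 1 + 1 ≠ 0 := by
    simpa [succ_nsmul] using hne 4 (by omega) (by omega)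
  have hgen : ∀ x : Fin n, ∃ k : ℕ, x = k • 1 := fun x =>
    ⟨x, Fin.ext (by rw [Fin.val_nsmul_one, Nat.mod_eq_of_lt x.isLt])⟩
  have hS' : ∀ i j, S i j = if j = i ∨ j = i + 1 then 0 else MvPolynomial.X (i, j) := by
    intro i j
    rw [hS]
    simp only [Fin.ext_iff, Fin.val_add, Fin.val_one', Nat.add_mod_mod]
  have hcount : ∀ (R C : Finset (Fin n)) (hR : R.card = 4) (hC : C.card = 4),
      ((S.submatrix (fun i => ((R.orderIsoOfFin hR) i : Fin n))
        (fun j => ((C.orderIsoOfFin hC) j : Fin n))).det).support.card =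
      (Finset.univ.filter fun σ : Equiv.Perm (Fin 4) => ∀ k,
        ¬ ((C.orderIsoOfFin hC k : Fin n) = R.orderIsoOfFin hR (σ k) ∨
          (C.orderIsoOfFin hC k : Fin n) = R.orderIsoOfFin hR (σ k) + 1)).card := by
    intro R C hR hC
    convert card_support_det (fun i => ((R.orderIsoOfFin hR) i : Fin n))
      (fun j => ((C.orderIsoOfFin hC) j : Fin n))
      (Subtype.val_injective.comp (R.orderIsoOfFin hR).injective)
      (Subtype.val_injective.comp (C.orderIsoOfFin hC).injective)
      (fun a b => (C.orderIsoOfFin hC b : Fin n) = R.orderIsoOfFin hR a ∨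
        (C.orderIsoOfFin hC b : Fin n) = R.orderIsoOfFin hR a + 1) (S.submatrix _ _) fun i j => hS' _ _
  let f : Fin n × Bool → Finset (Fin n) × Finset (Fin n) :=
    fun q => (arc 1 q.1, arc 1 (if q.2 then q.1 + 1 else q.1))
  have hf : Function.Injective f := by
    rintro ⟨i, s⟩ ⟨j, t⟩ h
    simp only [f, Prod.mk.injEq, (arc_injective h4 h3).eq_iff] at h
    obtain ⟨rfl, h⟩ := h
    cases s <;> cases t <;> simp_all
  have hset : {p : Finset (Fin n) × Finset (Fin n) |
      ∃ (hR : p.1.card = 4) (hC : p.2.card = 4),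
        ((S.submatrix (fun i => ((p.1.orderIsoOfFin hR) i : Fin n))
            (fun j => ((p.2.orderIsoOfFin hC) j : Fin n))).det).support.card = 3} =
      f '' Set.univ := by
    ext ⟨R, C⟩
    simp only [Set.mem_ofPred_eq, Set.image_univ, Set.mem_range, Prod.exists]
    constructor
    · rintro ⟨hR, hC, h⟩
      rw [hcount] at h
      have hsum := sum_eq_seven_of_card_perm_eq_three
        (fun a b => decide ((C.orderIsoOfFin hC b : Fin n) = R.orderIsoOfFin hR a ∨
          (C.orderIsoOfFin hC b : Fin n) = R.orderIsoOfFin hR a + 1))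
        (fun a => by
          rw [sum_orderIsoOfFin hC fun y => (decide (y = (R.orderIsoOfFin hR a : Fin n) ∨
            y = (R.orderIsoOfFin hR a : Fin n) + 1)).toNat, sum_slack_row h1]
          split_ifs <;> simp)
        (fun b => by
          rw [sum_orderIsoOfFin hR fun x => (decide ((C.orderIsoOfFin hC b : Fin n) = x ∨
            (C.orderIsoOfFin hC b : Fin n) = x + 1)).toNat]
          exact sum_slack_col_le h1 _ _)
        (by simpa only [decide_eq_true_eq] using h)
      have hrow : ∀ a, ∑ b, (decide ((C.orderIsoOfFin hC b : Fin n) = R.orderIsoOfFin hR a ∨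
          (C.orderIsoOfFin hC b : Fin n) = R.orderIsoOfFin hR a + 1)).toNat =
          (if (R.orderIsoOfFin hR a : Fin n) ∈ C then 1 else 0) +
            if (R.orderIsoOfFin hR a : Fin n) + 1 ∈ C then 1 else 0 := fun a => by
        rw [sum_orderIsoOfFin hC fun y => (decide (y = (R.orderIsoOfFin hR a : Fin n) ∨
          y = (R.orderIsoOfFin hR a : Fin n) + 1)).toNat, sum_slack_row h1]
      simp only [hrow] at hsum
      rw [sum_orderIsoOfFin hR fun x => (if x ∈ C then 1 else 0) + if x + 1 ∈ C then 1 else 0,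
        Finset.sum_add_distrib, ← Finset.card_filter, ← Finset.card_filter] at hsum
      obtain ⟨i, rfl, rfl | rfl⟩ := eq_arc_of_card_filter hgen hR hC hsum
      · exact ⟨i, false, by simp [f]⟩
      · exact ⟨i, true, by simp [f]⟩
    · rintro ⟨i, t, h⟩
      obtain ⟨rfl, rfl⟩ := Prod.mk.inj h
      refine ⟨card_arc h3 h2 _, card_arc h3 h2 _, ?_⟩
      rw [hcount]
      obtain ⟨α, hα⟩ := orderIsoOfFin_factor (card_arc h3 h2 i) _
        (arcVec_injective h3 h2 i) (arcVec_mem 1 i)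
      obtain ⟨β, hβ⟩ := orderIsoOfFin_factor (card_arc h3 h2 (if t then i + 1 else i)) _
        (arcVec_injective h3 h2 _) (arcVec_mem 1 _)
      rw [← card_perm_arc h4 h3 h1 i t]
      simp only [← hα, ← hβ]
      convert (card_perm_reindex (fun a b =>
        ((arc 1 (if t then i + 1 else i)).orderIsoOfFin (card_arc h3 h2 _) b : Fin n) =
          (arc 1 i).orderIsoOfFin (card_arc h3 h2 i) a ∨
        ((arc 1 (if t then i + 1 else i)).orderIsoOfFin (card_arc h3 h2 _) b : Fin n) =
          (arc 1 i).orderIsoOfFin (card_arc h3 h2 i) a + 1) α β).symm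
  rw [hset, Set.ncard_image_of_injective _ hf, Set.ncard_univ]
  simp [mul_comm]
end

section
/- Let n ≥ 7 and let S be an n×n real matrix satisfying: S_{ij} = 0 if j = i or j = i+1 (indices taken mod n, 1-indexed), S_{ij} > 0 for all other entries, and rank S = 3. Then there is no n×n complex matrix M with rank M = 3 such that S_{ij} = |M_{ij}|² for all i, j. -/
open scoped Matrix

/-- The bracket `[i, i + 1, j]` of three members of a sequence of vectors in dimension three. -/
def edgeBracket {K : Type*} [CommRing K] (V : ℕ → Fin 3 → K) (i j : ℕ) : K :=
  (V i ⨯₃ V (i + 1)) ⬝ᵥ V j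

theorem edgeBracket_add_two {K : Type*} [CommRing K] (V : ℕ → Fin 3 → K) (i : ℕ) :
    edgeBracket V i (i + 2) = edgeBracket V (i + 1) i := by
  simp only [edgeBracket, cross_apply, Matrix.vec3_dotProduct, Matrix.cons_val]
  ring

/-- The three-term Plücker relation whose terms are all brackets of two adjacent vectors and
a third one. -/
theorem edgeBracket_plucker {K : Type*} [CommRing K] (V : ℕ → Fin 3 → K) (i a : ℕ) :
    edgeBracket V (i + 1) (a + 1) * edgeBracket V i a =
      edgeBracket V (i + 1) a * edgeBracket V i (a + 1) +
        edgeBracket V (i + 1) i * edgeBracket V a (i + 1) := by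
  simp only [edgeBracket, cross_apply, Matrix.vec3_dotProduct, Matrix.cons_val]
  ring

/-- A vector annihilating `u` and `v` is a multiple of `u ⨯₃ v`, provided some vector
annihilates `v` but not `u`, and `v` is nonzero. -/
theorem exists_eq_smul_cross {K : Type*} [Field K] {a b u v : Fin 3 → K}
    (hau : a ⬝ᵥ u = 0) (hav : a ⬝ᵥ v = 0) (hbv : b ⬝ᵥ v = 0) (hbu : b ⬝ᵥ u ≠ 0) (hv : v ≠ 0) :
    ∃ r : K, a = r • (u ⨯₃ v) := by
  have hw : u ⨯₃ v ≠ 0 := by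
    intro h
    have h0 := congrFun h 0
    have h1 := congrFun h 1
    have h2 := congrFun h 2
    rw [Matrix.vec3_dotProduct] at hbu hbv
    simp only [cross_apply, Matrix.cons_val, Pi.zero_apply] at h0 h1 h2
    apply hv
    ext k
    apply (mul_eq_zero.mp (?_ : (b 0 * u 0 + b 1 * u 1 + b 2 * u 2) * v k = 0)).resolve_left hbu
    fin_cases k <;> simp only [Fin.zero_eta, Fin.mk_one, Fin.reduceFinMk]
    · linear_combination u 0 * hbv + b 1 * -h2 + b 2 * h1
    · linear_combination u 1 * hbv + b 0 * h2 - b 2 * h0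
    · linear_combination u 2 * hbv - b 0 * h1 + b 1 * h0
  obtain ⟨k, hk⟩ := Function.ne_iff.mp hw
  refine ⟨a k / (u ⨯₃ v) k, ?_⟩
  have hpar : ∀ l, a l * (u ⨯₃ v) k = a k * (u ⨯₃ v) l := by
    rw [Matrix.vec3_dotProduct] at hau hav
    intro l
    fin_cases k <;> fin_cases l <;>
      simp only [cross_apply, Matrix.cons_val, Fin.zero_eta, Fin.mk_one, Fin.reduceFinMk]
    · linear_combination v 2 * hau - u 2 * hav
    · linear_combination u 1 * hav - v 1 * hau
    · linear_combination u 2 * hav - v 2 * hau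
    · linear_combination v 0 * hau - u 0 * hav
    · linear_combination v 1 * hau - u 1 * hav
    · linear_combination u 0 * hav - v 0 * hau
  ext l
  rw [Pi.smul_apply, smul_eq_mul, div_mul_eq_mul_div, eq_div_iff hk, hpar]

/-- A matrix of rank `r` factors through dimension `r`. -/
theorem Matrix.exists_eq_dotProduct_of_rank_eq {K m n : Type*} [Field K] [Fintype m] [Fintype n]
    {r : ℕ} (M : Matrix m n K) (hM : M.rank = r) :
    ∃ (A : m → Fin r → K) (V : n → Fin r → K), ∀ i j, M i j = A i ⬝ᵥ V j := by
  classical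
  let b := Module.finBasisOfFinrankEq K (LinearMap.range M.mulVecLin) hM
  refine ⟨fun i k => (b k : m → K) i,
    fun j => b.repr ⟨M.mulVecLin (Pi.single j 1), LinearMap.mem_range_self _ _⟩, fun i j => ?_⟩
  have h := congrArg (fun x : LinearMap.range M.mulVecLin => (x : m → K) i)
    (b.sum_repr ⟨M.mulVecLin (Pi.single j 1), LinearMap.mem_range_self _ _⟩)
  simp only [Submodule.coe_sum, Finset.sum_apply, Submodule.coe_smul, Pi.smul_apply,
    smul_eq_mul, Matrix.mulVecLin_apply, Matrix.mulVec_single_one, Matrix.col_apply] at h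
  rw [← h]
  exact Finset.sum_congr rfl fun k _ => by simp [mul_comm]

/-- A rank-three matrix with the cyclic support pattern is, up to scaling of rows, given by the
brackets of a sequence of vectors. -/
theorem exists_eq_mul_edgeBracket {K : Type*} [Field K] {n : ℕ} [NeZero n] (hn : 7 ≤ n)
    (M : Matrix (Fin n) (Fin n) K) (hM : M.rank = 3)
    (hzero : ∀ i j : Fin n, ((j : ℕ) = (i : ℕ) ∨ (j : ℕ) = ((i : ℕ) + 1) % n) → M i j = 0)
    (hne : ∀ i j : Fin n, ¬((j : ℕ) = (i : ℕ) ∨ (j : ℕ) = ((i : ℕ) + 1) % n) → M i j ≠ 0) :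
    ∃ (ρ : ℕ → K) (V : ℕ → Fin 3 → K),
      ∀ i j, M (Fin.ofNat n i) (Fin.ofNat n j) = ρ i * edgeBracket V i j := by
  obtain ⟨A, V, hAV⟩ := M.exists_eq_dotProduct_of_rank_eq hM
  have key : ∀ i : ℕ, ∃ r : K, A (Fin.ofNat n i) =
      r • (V (Fin.ofNat n i) ⨯₃ V (Fin.ofNat n (i + 1))) := by
    intro i
    have hi : i % n < n := Nat.mod_lt i (by omega)
    have hsucc : ∀ k < n, (k + 1) % n = if k + 1 = n then 0 else k + 1 := by
      intro k hk
      split_ifs with h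
      · rw [h, Nat.mod_self]
      · exact Nat.mod_eq_of_lt (by omega)
    have hi₁ : (i + 1) % n = (i % n + 1) % n := (Nat.mod_add_mod i n 1).symm
    have hi₂ : (i + 2) % n = ((i + 1) % n + 1) % n := (Nat.mod_add_mod (i + 1) n 1).symm
    have hlt₁ : (i + 1) % n < n := Nat.mod_lt _ (by omega)
    have hlt₂ : (i + 2) % n < n := Nat.mod_lt _ (by omega)
    have hv : V (Fin.ofNat n (i + 1)) ≠ 0 := by
      intro h
      refine hne (Fin.ofNat n (i + 2)) (Fin.ofNat n (i + 1)) ?_ (by rw [hAV, h, dotProduct_zero])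
      simp only [Fin.val_ofNat]
      grind
    refine exists_eq_smul_cross (b := A (Fin.ofNat n (i + 1))) ?_ ?_ ?_ ?_ hv <;> rw [← hAV]
    · exact hzero _ _ (Or.inl rfl)
    · exact hzero _ _ (Or.inr hi₁)
    · exact hzero _ _ (Or.inl rfl)
    · apply hne
      simp only [Fin.val_ofNat]
      grind
  choose ρ hρ using key
  refine ⟨ρ, fun j => V (Fin.ofNat n j), fun i j => ?_⟩
  rw [hAV, hρ, smul_dotProduct, smul_eq_mul, edgeBracket]

/-- If `‖p + q‖² = ‖p‖² + ‖q‖²` then `p / q` is purely imaginary. -/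
theorem exists_eq_mul_I_mul {p q : ℂ} (hp : p ≠ 0) (hq : q ≠ 0)
    (h : Complex.normSq (p + q) = Complex.normSq p + Complex.normSq q) :
    ∃ t : ℝ, t ≠ 0 ∧ p = t * Complex.I * q := by
  rw [Complex.normSq_add] at h
  have hre : (p / q).re = 0 := by
    rw [Complex.div_re]
    simp only [Complex.mul_re, Complex.conj_re, Complex.conj_im] at h
    rw [← add_div, div_eq_zero_iff]
    left; linarith
  have hpq : p / q = (p / q).im * Complex.I := by
    apply Complex.ext <;> simp [hre]
  refine ⟨(p / q).im, fun h0 => ?_, ?_⟩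
  · rw [h0, Complex.ofReal_zero, zero_mul] at hpq
    exact div_ne_zero hp hq hpq
  · rw [← hpq, div_mul_cancel₀ _ hq]

/-- The squared absolute values of the brackets of seven consecutive complex vectors are not a
constant multiple of the brackets of seven consecutive real vectors. -/
theorem not_normSq_edgeBracket_eq (V : ℕ → Fin 3 → ℂ) (W : ℕ → Fin 3 → ℝ) (κ : ℝ)
    (h : ∀ i < 6, ∀ j < 7, Complex.normSq (edgeBracket V i j) = κ * edgeBracket W i j)
    (hne : ∀ i < 6, ∀ j < 7, j ≠ i → j ≠ i + 1 → edgeBracket V i j ≠ 0) : False := by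
  have key : ∀ i < 5, ∀ a < 6, a ≠ i → a ≠ i + 1 → a ≠ i + 2 → a + 1 ≠ i →
      ∃ t : ℝ, t ≠ 0 ∧ edgeBracket V (i + 1) a * edgeBracket V i (a + 1) =
        t * Complex.I * (edgeBracket V (i + 1) i * edgeBracket V a (i + 1)) := by
    intro i hi a ha h1 h2 h3 h4
    apply exists_eq_mul_I_mul
    · apply mul_ne_zero <;> apply hne <;> omega
    · apply mul_ne_zero <;> apply hne <;> omega
    · rw [← edgeBracket_plucker]
      simp only [Complex.normSq_mul]
      rw [h (i + 1) (by omega) (a + 1) (by omega), h i (by omega) a (by omega),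
        h (i + 1) (by omega) a (by omega), h i (by omega) (a + 1) (by omega),
        h (i + 1) (by omega) i (by omega), h a (by omega) (i + 1) (by omega)]
      linear_combination κ ^ 2 * edgeBracket_plucker W i a
  have s2 := edgeBracket_add_two V 2
  obtain ⟨t₁, ht₁, e₁⟩ := key 0 (by omega) 4 (by omega) (by omega) (by omega) (by omega) (by omega)
  obtain ⟨t₂, ht₂, e₂⟩ := key 1 (by omega) 4 (by omega) (by omega) (by omega) (by omega) (by omega)
  obtain ⟨t₃, ht₃, e₃⟩ := key 1 (by omega) 5 (by omega) (by omega) (by omega) (by omega) (by omega)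
  obtain ⟨t₄, ht₄, e₄⟩ := key 3 (by omega) 1 (by omega) (by omega) (by omega) (by omega) (by omega)
  obtain ⟨t₅, ht₅, e₅⟩ := key 4 (by omega) 1 (by omega) (by omega) (by omega) (by omega) (by omega)
  obtain ⟨t₆, ht₆, e₆⟩ := key 4 (by omega) 2 (by omega) (by omega) (by omega) (by omega) (by omega)
  obtain ⟨t₀, ht₀, e₀⟩ := key 0 (by omega) 5 (by omega) (by omega) (by omega) (by omega) (by omega)
  have e := edgeBracket_plucker V 0 5
  simp only [Nat.reduceAdd, zero_add] at s2 e e₀ e₁ e₂ e₃ e₄ e₅ e₆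
  rw [s2] at e₂
  have hprod : (edgeBracket V 1 0 * edgeBracket V 5 1) *
      (edgeBracket V 1 4 * edgeBracket V 0 5) * (edgeBracket V 2 1 * edgeBracket V 4 2) *
      (edgeBracket V 2 5 * edgeBracket V 1 6) * (edgeBracket V 4 1 * edgeBracket V 3 2) *
      (edgeBracket V 5 4 * edgeBracket V 1 5) * (edgeBracket V 5 2 * edgeBracket V 4 3) =
      (edgeBracket V 1 6 * edgeBracket V 0 5) *
      (edgeBracket V 1 0 * edgeBracket V 4 1) * (edgeBracket V 3 2 * edgeBracket V 1 5) *
      (edgeBracket V 2 1 * edgeBracket V 5 2) * (edgeBracket V 4 3 * edgeBracket V 1 4) *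
      (edgeBracket V 5 1 * edgeBracket V 4 2) * (edgeBracket V 5 4 * edgeBracket V 2 5) := by
    ring
  rw [e, e₀, e₁, e₂, e₃, e₄, e₅, e₆] at hprod
  obtain ⟨d, hd⟩ : ∃ d, d = (edgeBracket V 1 0 * edgeBracket V 5 1) *
      (edgeBracket V 1 0 * edgeBracket V 4 1) * (edgeBracket V 2 1 * edgeBracket V 4 2) *
      (edgeBracket V 2 1 * edgeBracket V 5 2) * (edgeBracket V 4 3 * edgeBracket V 1 4) *
      (edgeBracket V 5 4 * edgeBracket V 1 5) * (edgeBracket V 5 4 * edgeBracket V 2 5) := ⟨_, rfl⟩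
  have hd₀ : d ≠ 0 := by
    rw [hd]
    repeat' apply mul_ne_zero
    all_goals apply hne <;> norm_num
  have hz : ((t₁ * t₃ * t₄ * t₆ + t₂ * t₅ : ℝ) + (t₂ * t₅ * t₀ : ℝ) * Complex.I) * d = 0 := by
    push_cast
    linear_combination hprod + d * (t₁ * t₃ * t₄ * t₆ * (1 - Complex.I ^ 2) +
      t₂ * t₅ * (1 + t₀ * Complex.I)) * Complex.I_sq + (t₁ * t₃ * t₄ * t₆ * Complex.I ^ 4 -
      t₂ * t₅ * (1 + t₀ * Complex.I) * Complex.I ^ 2) * hd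
  have him := congrArg Complex.im ((mul_eq_zero.mp hz).resolve_right hd₀)
  rw [Complex.add_im, Complex.ofReal_im, Complex.im_ofReal_mul, Complex.I_im, zero_add, mul_one,
    Complex.zero_im] at him
  exact mul_ne_zero (mul_ne_zero ht₂ ht₅) ht₀ him

/-- **Proposition 3.3**: for `n ≥ 7`, `n`-gons are not complex psd-minimal. A scaled
slack matrix of an `n`-gon (cyclic `n`-gon support pattern, positive elsewhere, rank 3)
admits no entrywise complex Hadamard square root of rank 3. -/
theorem stmt_7 (n : ℕ) (hn : 7 ≤ n) (S : Matrix (Fin n) (Fin n) ℝ)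
    (hzero : ∀ i j : Fin n, ((j : ℕ) = (i : ℕ) ∨ (j : ℕ) = ((i : ℕ) + 1) % n) → S i j = 0)
    (hpos : ∀ i j : Fin n, ¬((j : ℕ) = (i : ℕ) ∨ (j : ℕ) = ((i : ℕ) + 1) % n) → 0 < S i j)
    (hrank : S.rank = 3) :
    ¬ ∃ M : Matrix (Fin n) (Fin n) ℂ,
        M.rank = 3 ∧ ∀ i j : Fin n, S i j = Complex.normSq (M i j) := by
  have : NeZero n := ⟨by omega⟩
  rintro ⟨M, hMrank, hM⟩
  have hSne : ∀ i j : Fin n, ¬((j : ℕ) = (i : ℕ) ∨ (j : ℕ) = ((i : ℕ) + 1) % n) → S i j ≠ 0 :=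
    fun i j h => (hpos i j h).ne'
  obtain ⟨σ, W, hW⟩ := exists_eq_mul_edgeBracket hn S hrank hzero hSne
  obtain ⟨ρ, V, hV⟩ := exists_eq_mul_edgeBracket hn M hMrank
    (fun i j h => Complex.normSq_eq_zero.mp (by rw [← hM, hzero i j h]))
    (fun i j h h0 => hSne i j h (by rw [hM, h0, Complex.normSq_zero]))
  have hentry : ∀ i < 6, ∀ j < 7, j ≠ i → j ≠ i + 1 →
      S (Fin.ofNat n i) (Fin.ofNat n j) ≠ 0 := by
    intro i hi j hj h1 h2
    apply hSne
    simp only [Fin.val_ofNat]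
    rw [Nat.mod_eq_of_lt (by omega : i < n), Nat.mod_eq_of_lt (by omega : j < n),
      Nat.mod_eq_of_lt (by omega : i + 1 < n)]
    omega
  have hnorm : ∀ i j, σ i * edgeBracket W i j =
      Complex.normSq (ρ i) * Complex.normSq (edgeBracket V i j) := by
    intro i j
    rw [← hW, hM, hV, Complex.normSq_mul]
  have hVne : ∀ i < 6, ∀ j < 7, j ≠ i → j ≠ i + 1 → edgeBracket V i j ≠ 0 := by
    intro i hi j hj h1 h2 h0
    apply hentry i hi j hj h1 h2
    rw [hM, hV, h0, mul_zero, Complex.normSq_zero]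
  have hWne : ∀ i < 6, ∀ j < 7, j ≠ i → j ≠ i + 1 → edgeBracket W i j ≠ 0 := by
    intro i hi j hj h1 h2 h0
    apply hentry i hi j hj h1 h2
    rw [hW, h0, mul_zero]
  have hρ : ∀ i < 6, Complex.normSq (ρ i) ≠ 0 := by
    intro i hi h0
    obtain ⟨j, hj, h1, h2⟩ : ∃ j < 7, j ≠ i ∧ j ≠ i + 1 := by
      by_cases h : i < 2
      · exact ⟨i + 2, by omega⟩
      · exact ⟨0, by omega⟩
    apply hentry i hi j hj h1 h2
    rw [hM, hV, Complex.normSq_mul, h0, zero_mul]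
  have hratio : ∀ i < 6, ∀ j, Complex.normSq (edgeBracket V i j) =
      σ i / Complex.normSq (ρ i) * edgeBracket W i j := by
    intro i hi j
    rw [div_mul_eq_mul_div, eq_div_iff (hρ i hi), hnorm, mul_comm]
  have hconst : ∀ i < 6, σ i / Complex.normSq (ρ i) = σ 0 / Complex.normSq (ρ 0) := by
    intro i
    induction i with
    | zero => exact fun _ => rfl
    | succ i ih =>
      intro hi
      rw [← ih (by omega)]
      apply mul_right_cancel₀ (hWne (i + 1) hi i (by omega) (by omega) (by omega))
      rw [← hratio (i + 1) hi, ← edgeBracket_add_two, ← edgeBracket_add_two, ← hratio i (by omega)]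
  exact not_normSq_edgeBracket_eq V W _
    (fun i hi j _ => (hratio i hi j).trans (by rw [hconst i hi])) hVne
end

section
/- Let S be a 6×6 real matrix satisfying: S_{ij} = 0 if j = i or j = i+1 (indices taken mod 6, 1-indexed), S_{ij} > 0 for all other entries, and rank S = 3. If there exists a 6×6 complex matrix M with rank M = 3 such that S_{ij} = |M_{ij}|² for all i, j, then S_{5,1}·S_{2,4} = S_{2,1}·S_{5,4}. -/
open Complex in
theorem Complex.exists_eq_one_add_mul_I {w : ℂ} (h : normSq (w - 1) = normSq w - 1) :
    ∃ t : ℝ, w = 1 + t * I := by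
  refine ⟨w.im, Complex.ext ?_ ?_⟩
  · simp only [normSq_apply, sub_re, one_re, sub_im, one_im] at h
    simp
    linarith
  · simp

open Complex in
/-- If passing to squared moduli commutes with the differences defining the entries of a hexagon
matrix with parameters `p, q, y, z`, then the squared moduli satisfy the Pappus condition. -/
theorem pappus_of_normSq {p q y z : ℂ} (hp : p ≠ 0) (hp1 : 1 - p ≠ 0) (hy : y ≠ 0)
    (hzy : z - y ≠ 0)
    (h₁ : normSq (1 - p) = 1 - normSq p)
    (h₂ : normSq (q * (1 - p) - 1) = normSq q * (1 - normSq p) - 1)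
    (h₃ : normSq (y - 1) = normSq y - 1)
    (h₄ : normSq (z - y) = normSq z - normSq y)
    (h₅ : normSq (y * q - z) = normSq y * normSq q - normSq z)
    (h₆ : normSq (y * q - z - q * p)
      = normSq y * normSq q - normSq z - normSq q * normSq p)
    (h₇ : normSq (1 - z + q * (y - 1)) = 1 - normSq z + normSq q * (normSq y - 1))
    (h₈ : normSq (p - y + z * (1 - p)) = normSq p - normSq y + normSq z * (1 - normSq p)) :
    normSq p * normSq q * (normSq y - 1) = normSq z - normSq y := by
  obtain ⟨a, ha⟩ := exists_eq_one_add_mul_I h₃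
  obtain ⟨b, hb⟩ : ∃ b : ℝ, z / y = 1 + b * I := by
    apply exists_eq_one_add_mul_I
    have : z / y - 1 = (z - y) / y := by field_simp
    rw [this, normSq_div, normSq_div, h₄]
    have := normSq_pos.2 hy
    field_simp
  obtain ⟨c, hc⟩ : ∃ c : ℝ, 1 / p = 1 + c * I := by
    apply exists_eq_one_add_mul_I
    have : 1 / p - 1 = (1 - p) / p := by field_simp
    rw [this, normSq_div, normSq_div, h₁]
    have := normSq_pos.2 hp
    field_simp
    simp
  obtain ⟨d, hd⟩ : ∃ d : ℝ, q * (1 - p) = 1 + d * I := by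
    apply exists_eq_one_add_mul_I
    rw [h₂, normSq_mul, h₁]
  have hz' : z = (1 + a * I) * (1 + b * I) := by rw [← ha, ← hb]; field_simp
  have hp' : (1 + c * I) * p = 1 := by rw [← hc]; field_simp
  have hq' : c * I * q = (1 + d * I) * (1 + c * I) := by
    linear_combination (1 + c * I) * hd + q * hp'
  have hc0 : c ≠ 0 := by
    rintro rfl
    apply hp1
    simpa [sub_eq_zero] using hp'.symm
  have hb0 : b ≠ 0 := by
    rintro rfl
    apply hzy
    rw [hz', ha]; simp
  have nsq : ∀ r : ℝ, normSq (1 + r * I) = 1 + r ^ 2 := fun r => by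
    simp [normSq_apply]; ring
  have hY : normSq y = 1 + a ^ 2 := by rw [ha, nsq]
  have hZ : normSq z = (1 + a ^ 2) * (1 + b ^ 2) := by rw [hz', normSq_mul, nsq, nsq]
  have hP : (1 + c ^ 2) * normSq p = 1 := by
    rw [← nsq, ← normSq_mul, hp', normSq_one]
  have hQ : c ^ 2 * normSq q = (1 + d ^ 2) * (1 + c ^ 2) := by
    rw [← nsq, ← nsq, ← normSq_mul, ← hq', normSq_mul, normSq_mul, normSq_ofReal, normSq_I]
    ring
  have hPQ : c ^ 2 * (normSq p * normSq q) = 1 + d ^ 2 := by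
    linear_combination normSq p * hQ + (1 + d ^ 2) * hP
  suffices H : (1 + d ^ 2) * a ^ 2 = c ^ 2 * ((1 + a ^ 2) * b ^ 2) by
    apply mul_left_cancel₀ (pow_ne_zero 2 hc0)
    rw [hY, hZ]
    linear_combination a ^ 2 * hPQ + H
  have cart : ∀ {w : ℂ} (u v : ℝ), w = u + v * I → normSq w = u ^ 2 + v ^ 2 := by
    rintro _ u v rfl
    simp [normSq_apply]; ring
  have E₁ : (d - b) * (1 + b * c) = 0 := by
    have e : normSq (c * I * (y * q - z)) = c ^ 2 * (normSq y * normSq q - normSq z) := by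
      simp only [normSq_mul, normSq_ofReal, normSq_I, h₅]; ring
    have f : c * I * (y * q - z) = (1 + a * I) *
        (((1 - c * d + b * c : ℝ) : ℂ) + ((d : ℝ) : ℂ) * I) := by
      rw [hz', ha]; push_cast
      linear_combination (1 + a * I) * hq' + (1 + a * I) * (c * d - b * c) * I_sq
    rw [f, normSq_mul, nsq, cart _ _ rfl, hY, hZ] at e
    have : (1 + a ^ 2) * ((d - b) * (1 + b * c) * c) = 0 := by
      linear_combination (-1 / 2) * e - (1 + a ^ 2) / 2 * hQ
    have ha1 : 1 + a ^ 2 ≠ 0 := by positivity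
    simpa [ha1, hc0] using this
  have E₂ : (b - d) * (1 + a * d) = 0 := by
    have e : normSq (c * I * (y * q - z - q * p))
        = c ^ 2 * (normSq y * normSq q - normSq z - normSq q * normSq p) := by
      simp only [normSq_mul, normSq_ofReal, normSq_I, h₆]; ring
    have f : c * I * (y * q - z - q * p) =
        (((b - d) * c - a * d : ℝ) : ℂ) + ((a * (1 - c * d + b * c) : ℝ) : ℂ) * I := by
      have hqp : c * I * q * p = 1 + d * I := by
        linear_combination p * hq' + (1 + d * I) * hp'
      rw [hz', ha]; push_cast
      linear_combination (1 + a * I) * hq' - hqp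
        + ((1 + a * I) * (c * d - b * c) + a * d) * I_sq
    rw [cart _ _ f, hY, hZ] at e
    have : (b - d) * (1 + a * d) * c = 0 := by
      linear_combination (-1 / 2) * e - (1 + a ^ 2) / 2 * hQ + 1 / 2 * hPQ - (1 + a ^ 2) * c * E₁
    simpa [hc0] using this
  rcases eq_or_ne d b with rfl | hdb
  · have E₃ : a = c := by
      have e : normSq (c * I * (1 - z + q * (y - 1)))
          = c ^ 2 * (1 - normSq z + normSq q * (normSq y - 1)) := by
        simp only [normSq_mul, normSq_ofReal, normSq_I, h₇]; ring
      have f : c * I * (1 - z + q * (y - 1)) =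
          ((d * (c - a) : ℝ) : ℂ) + ((a : ℝ) : ℂ) * I := by
        rw [hz', ha]; push_cast
        linear_combination a * I * hq' + (a * d - c * d) * I_sq
      rw [cart _ _ f, hY, hZ] at e
      have : d ^ 2 * c * (a - c) = 0 := by
        linear_combination (-1 / 2) * e - a ^ 2 / 2 * hQ
      simpa [hc0, hb0, sub_eq_zero] using this
    subst E₃
    have E₄ : a * d = -1 := by
      have e : normSq ((1 + a * I) * (p - y + z * (1 - p)))
          = (1 + a ^ 2) * (normSq p - normSq y + normSq z * (1 - normSq p)) := by
        rw [normSq_mul, nsq, h₈]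
      have f : (1 + a * I) * (p - y + z * (1 - p)) =
          ((-(a * d) : ℝ) : ℂ) + ((-(a * (1 + a * d)) : ℝ) : ℂ) * I := by
        rw [hz', ha]; push_cast
        linear_combination (1 - (1 + a * I) * (1 + d * I)) * hp'
          + (a * d + a ^ 2 * d * I) * I_sq
      rw [cart _ _ f, hY, hZ] at e
      have : a ^ 2 * (1 + a * d) = 0 := by
        linear_combination 1 / 2 * e + 1 / 2 * (1 - (1 + a ^ 2) * (1 + d ^ 2)) * hP
      have h : 1 + a * d = 0 := by simpa [hc0] using this
      linarith
    linear_combination (-a ^ 2 * (a * d - 1)) * E₄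
  · have A : 1 + a * d = 0 := by simpa [sub_eq_zero, hdb.symm] using E₂
    have B : 1 + b * c = 0 := by simpa [sub_eq_zero, hdb] using E₁
    have A' : a * d = -1 := by linarith
    have B' : b * c = -1 := by linarith
    linear_combination (a * d - 1) * A' - (1 + a ^ 2) * (b * c - 1) * B'

/-- A `6 × 6` matrix of rank 3 with the cyclic hexagon support pattern, whose first three rows
become `(0, 0, 1, 1, 1, 1)`, `(1, 0, 0, p, 1, y)` and `(q, 1, 0, 0, 1, z)` after rescaling
rows and columns. -/
structure IsHexagonWithParams {K : Type*} [Field K] (M : Matrix (Fin 6) (Fin 6) K)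
    (p q y z : K) : Prop where
  zero : ∀ i j : Fin 6, (j = i ∨ j = i + 1) → M i j = 0
  ne_zero : ∀ i j : Fin 6, ¬(j = i ∨ j = i + 1) → M i j ≠ 0
  rank : M.rank = 3
  eq_p : M 1 3 * M 0 4 = p * M 0 3 * M 1 4
  eq_q : M 2 0 * M 1 4 = q * M 1 0 * M 2 4
  eq_y : M 1 5 * M 0 4 = y * M 0 5 * M 1 4
  eq_z : M 2 5 * M 0 4 = z * M 0 5 * M 2 4

namespace IsHexagonWithParams

variable {K : Type*} [Field K] {M : Matrix (Fin 6) (Fin 6) K} {p q y z : K}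

theorem exists_row_eq (h : IsHexagonWithParams M p q y z) (i : Fin 6) :
    ∃ α β γ : K, ∀ j, M i j = α * M 0 j + β * M 1 j + γ * M 2 j := by
  have n02 := h.ne_zero 0 2 (by decide)
  have n10 := h.ne_zero 1 0 (by decide)
  have n21 := h.ne_zero 2 1 (by decide)
  refine ⟨M i 2 / M 0 2, (M i 0 - M i 1 / M 2 1 * M 2 0) / M 1 0, M i 1 / M 2 1, fun j => ?_⟩
  have hdet : (M.submatrix ![0, 1, 2, i] ![0, 1, 2, j]).det = 0 := by
    by_contra hd
    have h4 := Matrix.rank_of_isUnit _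
      ((Matrix.isUnit_iff_isUnit_det _).2 (isUnit_iff_ne_zero.2 hd))
    have := M.rank_submatrix_le ![0, 1, 2, i] ![0, 1, 2, j]
    rw [h4, h.rank] at this
    simp at this
  simp only [Matrix.det_succ_row_zero, Fin.sum_univ_succ, Matrix.submatrix_apply] at hdet
  simp [Fin.succAbove, h.zero 0 0, h.zero 0 1, h.zero 1 1, h.zero 1 2, h.zero 2 2] at hdet
  field_simp
  linear_combination hdet

theorem row_three (h : IsHexagonWithParams M p q y z) : ∃ k : K,
    M 3 0 * M 1 4 = k * (q * (1 - p) - 1) * M 1 0 ∧ M 3 1 * M 2 4 = k * (1 - p) * M 2 1 ∧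
    M 3 2 * M 0 4 = k * p * M 0 2 ∧ M 3 5 * M 0 4 = k * (p - y + z * (1 - p)) * M 0 5 := by
  obtain ⟨α, β, γ, hr⟩ := h.exists_row_eq 3
  have n03 := h.ne_zero 0 3 (by decide)
  have hα : α * M 0 4 = -(β * M 1 4) * p := by
    have := hr 3
    rw [h.zero 3 3 (by decide), h.zero 2 3 (by decide)] at this
    apply mul_right_cancel₀ n03
    linear_combination -M 0 4 * this - β * h.eq_p
  have hγ : γ * M 2 4 = -(β * M 1 4) * (1 - p) := by
    have := hr 4
    rw [h.zero 3 4 (by decide)] at this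
    linear_combination -this - hα
  refine ⟨-(β * M 1 4), ?_, ?_, ?_, ?_⟩
  · rw [hr 0, h.zero 0 0 (by decide)]
    linear_combination γ * h.eq_q + q * M 1 0 * hγ
  · rw [hr 1, h.zero 0 1 (by decide), h.zero 1 1 (by decide)]
    linear_combination M 2 1 * hγ
  · rw [hr 2, h.zero 1 2 (by decide), h.zero 2 2 (by decide)]
    linear_combination M 0 2 * hα
  · rw [hr 5]
    linear_combination M 0 5 * hα + β * h.eq_y + γ * h.eq_z + z * M 0 5 * hγ

theorem row_four (h : IsHexagonWithParams M p q y z) : ∃ k : K,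
    M 4 0 * M 1 4 = k * (1 - z + q * (y - 1)) * M 1 0 ∧ M 4 1 * M 2 4 = k * (y - 1) * M 2 1 ∧
    M 4 2 * M 0 4 = k * (z - y) * M 0 2 ∧
    M 4 3 * M 0 4 = k * (z - y + p * (1 - z)) * M 0 3 := by
  obtain ⟨α, β, γ, hr⟩ := h.exists_row_eq 4
  have n05 := h.ne_zero 0 5 (by decide)
  have n04 := h.ne_zero 0 4 (by decide)
  have h4 : α * M 0 4 + β * M 1 4 + γ * M 2 4 = 0 := by
    rw [← hr 4, h.zero 4 4 (by decide)]
  have h5 : α * M 0 4 + y * (β * M 1 4) + z * (γ * M 2 4) = 0 := by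
    have := hr 5
    rw [h.zero 4 5 (by decide)] at this
    apply mul_right_cancel₀ n05
    linear_combination -M 0 4 * this - β * h.eq_y - γ * h.eq_z
  have hy : y - 1 ≠ 0 := by
    intro hy
    have h41 := hr 1
    rw [h.zero 0 1 (by decide), h.zero 1 1 (by decide)] at h41
    have hγ : γ ≠ 0 := by
      rintro rfl
      exact h.ne_zero 4 1 (by decide) (by simpa using h41)
    have hz : z - 1 = 0 := by
      have : γ * M 2 4 * (z - 1) = 0 := by linear_combination h5 - h4 - β * M 1 4 * hy
      simpa [hγ, h.ne_zero 2 4 (by decide)] using this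
    obtain ⟨k, -, -, -, h35⟩ := h.row_three
    have : M 3 5 * M 0 4 = 0 := by
      linear_combination h35 - k * M 0 5 * hy + k * M 0 5 * (1 - p) * hz
    simp [n04, h.ne_zero 3 5 (by decide)] at this
  obtain ⟨k, hγ⟩ : ∃ k, γ * M 2 4 = k * (y - 1) := ⟨γ * M 2 4 / (y - 1), by field_simp⟩
  have hβ : β * M 1 4 = k * (1 - z) := by
    apply mul_right_cancel₀ hy
    linear_combination h5 - h4 - (z - 1) * hγ
  have hα : α * M 0 4 = k * (z - y) := by linear_combination h4 - hβ - hγ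
  refine ⟨k, ?_, ?_, ?_, ?_⟩
  · rw [hr 0, h.zero 0 0 (by decide)]
    linear_combination γ * h.eq_q + q * M 1 0 * hγ + M 1 0 * hβ
  · rw [hr 1, h.zero 0 1 (by decide), h.zero 1 1 (by decide)]
    linear_combination M 2 1 * hγ
  · rw [hr 2, h.zero 1 2 (by decide), h.zero 2 2 (by decide)]
    linear_combination M 0 2 * hα
  · rw [hr 3, h.zero 2 3 (by decide)]
    linear_combination M 0 3 * hα + β * h.eq_p + p * M 0 3 * hβ

theorem row_five (h : IsHexagonWithParams M p q y z) : ∃ k : K,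
    M 5 1 * M 2 4 = k * M 2 1 ∧ M 5 2 * M 0 4 = k * (y * q - z) * M 0 2 ∧
    M 5 3 * M 0 4 = k * (y * q - z - q * p) * M 0 3 ∧
    M 5 4 = k * (1 - z + q * (y - 1)) := by
  obtain ⟨α, β, γ, hr⟩ := h.exists_row_eq 5
  have n05 := h.ne_zero 0 5 (by decide)
  have n10 := h.ne_zero 1 0 (by decide)
  have hβ : β * M 1 4 = -(γ * M 2 4) * q := by
    have := hr 0
    rw [h.zero 5 0 (by decide), h.zero 0 0 (by decide)] at this
    apply mul_right_cancel₀ n10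
    linear_combination -M 1 4 * this - γ * h.eq_q
  have hα : α * M 0 4 = γ * M 2 4 * (y * q - z) := by
    have := hr 5
    rw [h.zero 5 5 (by decide)] at this
    apply mul_right_cancel₀ n05
    linear_combination -M 0 4 * this - β * h.eq_y - γ * h.eq_z - y * M 0 5 * hβ
  refine ⟨γ * M 2 4, ?_, ?_, ?_, ?_⟩
  · rw [hr 1, h.zero 0 1 (by decide), h.zero 1 1 (by decide)]
    ring
  · rw [hr 2, h.zero 1 2 (by decide), h.zero 2 2 (by decide)]
    linear_combination M 0 2 * hα
  · rw [hr 3, h.zero 2 3 (by decide)]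
    linear_combination M 0 3 * hα + β * h.eq_p + p * M 0 3 * hβ
  · rw [hr 4]
    linear_combination hα + hβ

end IsHexagonWithParams

open Complex in
theorem Complex.normSq_eq_of_mul_eq {m w k f u : ℂ} {F K : ℝ} (hk : k ≠ 0) (hu : u ≠ 0)
    (hK : K = normSq k) (h : m * w = k * f * u)
    (h' : normSq m * normSq w = K * F * normSq u) : normSq f = F := by
  have hk' := normSq_pos.2 hk
  have hu' := normSq_pos.2 hu
  rw [← normSq_mul, h, normSq_mul, normSq_mul, hK] at h'
  exact mul_left_cancel₀ hk'.ne' (mul_right_cancel₀ hu'.ne' h')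

/-- Necessity direction of **Proposition 3.5**: a complex psd-minimal hexagon
satisfies the Pappus ratio condition `S₅₁·S₂₄ = S₂₁·S₅₄` (1-indexed; here the matrix
is 0-indexed, so the condition reads `S 4 0 * S 1 3 = S 1 0 * S 4 3`). -/
theorem stmt_8 (S : Matrix (Fin 6) (Fin 6) ℝ)
    (hzero : ∀ i j : Fin 6, (j = i ∨ j = i + 1) → S i j = 0)
    (hpos : ∀ i j : Fin 6, ¬(j = i ∨ j = i + 1) → 0 < S i j)
    (hrank : S.rank = 3)
    (hM : ∃ M : Matrix (Fin 6) (Fin 6) ℂ,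
        M.rank = 3 ∧ ∀ i j : Fin 6, S i j = Complex.normSq (M i j)) :
    S 4 0 * S 1 3 = S 1 0 * S 4 3 := by
  obtain ⟨M, hMr, hSM⟩ := hM
  have M_zero : ∀ i j : Fin 6, (j = i ∨ j = i + 1) → M i j = 0 := fun i j hij =>
    Complex.normSq_eq_zero.1 (by rw [← hSM, hzero i j hij])
  have M_ne : ∀ i j : Fin 6, ¬(j = i ∨ j = i + 1) → M i j ≠ 0 := fun i j hij =>
    Complex.normSq_pos.1 (by rw [← hSM]; exact hpos i j hij)
  have n02 := M_ne 0 2 (by decide)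
  have n03 := M_ne 0 3 (by decide)
  have n04 := M_ne 0 4 (by decide)
  have n05 := M_ne 0 5 (by decide)
  have n10 := M_ne 1 0 (by decide)
  have n14 := M_ne 1 4 (by decide)
  have n21 := M_ne 2 1 (by decide)
  have n24 := M_ne 2 4 (by decide)
  obtain ⟨p, hp⟩ : ∃ p, M 1 3 * M 0 4 = p * M 0 3 * M 1 4 :=
    ⟨M 1 3 * M 0 4 / (M 0 3 * M 1 4), by field_simp⟩
  obtain ⟨q, hq⟩ : ∃ q, M 2 0 * M 1 4 = q * M 1 0 * M 2 4 :=
    ⟨M 2 0 * M 1 4 / (M 1 0 * M 2 4), by field_simp⟩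
  obtain ⟨y, hy⟩ : ∃ y, M 1 5 * M 0 4 = y * M 0 5 * M 1 4 :=
    ⟨M 1 5 * M 0 4 / (M 0 5 * M 1 4), by field_simp⟩
  obtain ⟨z, hz⟩ : ∃ z, M 2 5 * M 0 4 = z * M 0 5 * M 2 4 :=
    ⟨M 2 5 * M 0 4 / (M 0 5 * M 2 4), by field_simp⟩
  have HM : IsHexagonWithParams M p q y z := ⟨M_zero, M_ne, hMr, hp, hq, hy, hz⟩
  have HS : IsHexagonWithParams S (Complex.normSq p) (Complex.normSq q) (Complex.normSq y)
      (Complex.normSq z) :=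
    ⟨hzero, fun i j hij => (hpos i j hij).ne', hrank,
      by simp only [hSM, ← Complex.normSq_mul, hp], by simp only [hSM, ← Complex.normSq_mul, hq],
      by simp only [hSM, ← Complex.normSq_mul, hy], by simp only [hSM, ← Complex.normSq_mul, hz]⟩
  obtain ⟨k₃, m30, m31, m32, m35⟩ := HM.row_three
  obtain ⟨k₄, m40, m41, m42, m43⟩ := HM.row_four
  obtain ⟨k₅, m51, m52, m53, m54⟩ := HM.row_five
  obtain ⟨l₃, s30, s31, s32, s35⟩ := HS.row_three
  obtain ⟨l₄, s40, s41, s42, s43⟩ := HS.row_four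
  obtain ⟨l₅, s51, s52, s53, s54⟩ := HS.row_five
  have hne {a b k f u : ℂ} (ha : a ≠ 0) (hb : b ≠ 0) (h : a * b = k * f * u) :
      k ≠ 0 ∧ f ≠ 0 := by
    have h0 := mul_ne_zero ha hb
    rw [h] at h0
    exact ⟨left_ne_zero_of_mul (left_ne_zero_of_mul h0),
      right_ne_zero_of_mul (left_ne_zero_of_mul h0)⟩
  obtain ⟨hk₃, hp0⟩ := hne (M_ne 3 2 (by decide)) n04 m32
  obtain ⟨-, hp1⟩ := hne (M_ne 3 1 (by decide)) n24 m31
  obtain ⟨hk₄, hzy⟩ := hne (M_ne 4 2 (by decide)) n04 m42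
  obtain ⟨-, hx⟩ := hne (M_ne 4 0 (by decide)) n14 m40
  obtain ⟨-, hk₅⟩ := hne (M_ne 5 1 (by decide)) n24 (by rw [m51, one_mul] : _ = 1 * k₅ * _)
  have hy0 : y ≠ 0 := by
    rintro rfl
    exact mul_ne_zero (M_ne 1 5 (by decide)) n04 (by simpa using hy)
  suffices h : Complex.normSq p * Complex.normSq q * (Complex.normSq y - 1)
      = Complex.normSq z - Complex.normSq y by
    apply mul_right_cancel₀ (mul_ne_zero (HS.ne_zero 1 4 (by decide)) (HS.ne_zero 0 4 (by decide)))
    linear_combination S 1 3 * S 0 4 * s40 - S 1 0 * S 1 4 * s43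
      + l₄ * (1 - Complex.normSq z + Complex.normSq q * (Complex.normSq y - 1)) * S 1 0 * HS.eq_p
      + l₄ * S 1 0 * S 0 3 * S 1 4 * h
  simp only [hSM] at s30 s31 s32 s35 s40 s41 s42 s43 s51 s52 s53 s54
  have hl₃ : l₃ = Complex.normSq k₃ :=
    (Complex.normSq_eq_of_mul_eq hp0 n02 rfl (by rw [m32, mul_comm k₃])
      (by rw [s32, mul_comm l₃])).symm
  have hl₅ : l₅ = Complex.normSq k₅ :=
    (Complex.normSq_eq_of_mul_eq one_ne_zero n21 rfl (by rw [m51, one_mul])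
      (by rw [s51, map_one, one_mul])).symm
  have h₇ : Complex.normSq (1 - z + q * (y - 1))
      = 1 - Complex.normSq z + Complex.normSq q * (Complex.normSq y - 1) :=
    Complex.normSq_eq_of_mul_eq (m := M 5 4) (w := 1) hk₅ one_ne_zero hl₅
      (by rw [mul_one, mul_one, m54]) (by simp [s54])
  have hl₄ : l₄ = Complex.normSq k₄ :=
    (Complex.normSq_eq_of_mul_eq hx n10 h₇.symm (by rw [m40, mul_comm k₄])
      (by rw [s40, mul_comm l₄])).symm
  exact pappus_of_normSq hp0 hp1 hy0 hzy
    (Complex.normSq_eq_of_mul_eq hk₃ n21 hl₃ m31 s31)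
    (Complex.normSq_eq_of_mul_eq hk₃ n10 hl₃ m30 s30)
    (Complex.normSq_eq_of_mul_eq hk₄ n21 hl₄ m41 s41)
    (Complex.normSq_eq_of_mul_eq hk₄ n02 hl₄ m42 s42)
    (Complex.normSq_eq_of_mul_eq hk₅ n02 hl₅ m52 s52)
    (Complex.normSq_eq_of_mul_eq hk₅ n03 hl₅ m53 s53) h₇
    (Complex.normSq_eq_of_mul_eq hk₃ n05 hl₃ m35 s35)
end

section
/- For all real numbers x₁, x₂, the point (x₁, x₂) belongs to the convex hull of the six points (cos(kπ/3), sin(kπ/3)), k = 0, 1, …, 5, in ℝ² if and only if there exist real numbers x₃, x₄, x₅ such that the 3×3 complex matrix with rows (2 − (4/√3)·x₂, 1 + x₃ + i·x₄ − x₅, 1 + x₃ + i·x₄ + x₅), (1 + x₃ − i·x₄ − x₅, 1 + x₁ + √3·x₂ + 2·x₃ − 2·x₅, 1 + x₃ − i·x₅), (1 + x₃ − i·x₄ + x₅, 1 + x₃ + i·x₅, 1 − x₁ − (1/√3)·x₂) is positive semidefinite. -/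
open ComplexOrder

/-- The Hermitian pencil whose positive semidefiniteness describes the regular hexagon. -/
noncomputable def hexagonPencil (x1 x2 x3 x4 x5 : ℝ) : Matrix (Fin 3) (Fin 3) ℂ :=
  !![2 - 4 / (Real.sqrt 3 : ℂ) * (x2 : ℂ),
      1 + (x3 : ℂ) + Complex.I * (x4 : ℂ) - (x5 : ℂ),
      1 + (x3 : ℂ) + Complex.I * (x4 : ℂ) + (x5 : ℂ);
    1 + (x3 : ℂ) - Complex.I * (x4 : ℂ) - (x5 : ℂ),
      1 + (x1 : ℂ) + (Real.sqrt 3 : ℂ) * (x2 : ℂ) + 2 * (x3 : ℂ) - 2 * (x5 : ℂ),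
      1 + (x3 : ℂ) - Complex.I * (x5 : ℂ);
    1 + (x3 : ℂ) - Complex.I * (x4 : ℂ) + (x5 : ℂ),
      1 + (x3 : ℂ) + Complex.I * (x5 : ℂ),
      1 - (x1 : ℂ) - 1 / (Real.sqrt 3 : ℂ) * (x2 : ℂ)]

/-- The vertices of the regular hexagon. -/
noncomputable def hexagonVertex (k : Fin 6) : Fin 2 → ℝ :=
  ![Real.cos ((k : ℕ) * Real.pi / 3), Real.sin ((k : ℕ) * Real.pi / 3)]

lemma hexagonVertex_zero : hexagonVertex 0 = ![1, 0] := by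
  simp [hexagonVertex]

lemma hexagonVertex_one : hexagonVertex 1 = ![1 / 2, √3 / 2] := by
  simp [hexagonVertex]

lemma hexagonVertex_two : hexagonVertex 2 = ![-(1 / 2), √3 / 2] := by
  have h : 2 * Real.pi / 3 = Real.pi - Real.pi / 3 := by ring
  simp [hexagonVertex, h, Real.cos_pi_sub, Real.sin_pi_sub]

lemma hexagonVertex_add_three (j k : Fin 6) (h : (k : ℕ) = j + 3) :
    hexagonVertex k = -hexagonVertex j := by
  have h' : ((k : ℕ) : ℝ) * Real.pi / 3 = (j : ℕ) * Real.pi / 3 + Real.pi := by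
    rw [h]; push_cast; ring
  ext i
  fin_cases i <;> simp [hexagonVertex, h']

lemma hexagonVertex_three : hexagonVertex 3 = ![-1, 0] := by
  simp [hexagonVertex_add_three 0 3 rfl, hexagonVertex_zero]

lemma hexagonVertex_four : hexagonVertex 4 = ![-(1 / 2), -(√3 / 2)] := by
  simp [hexagonVertex_add_three 1 4 rfl, hexagonVertex_one]

lemma hexagonVertex_five : hexagonVertex 5 = ![1 / 2, -(√3 / 2)] := by
  simp [hexagonVertex_add_three 2 5 rfl, hexagonVertex_two]

/-- The points admitting a lift to a positive semidefinite matrix in the pencil form a convex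
set. -/
lemma convex_setOf_exists_hexagonPencil_posSemidef :
    Convex ℝ {v : Fin 2 → ℝ | ∃ x3 x4 x5 : ℝ,
      (hexagonPencil (v 0) (v 1) x3 x4 x5).PosSemidef} := by
  rintro v ⟨a3, a4, a5, ha⟩ w ⟨b3, b4, b5, hb⟩ s t hs ht hst
  refine ⟨s * a3 + t * b3, s * a4 + t * b4, s * a5 + t * b5, ?_⟩
  convert (ha.smul hs).add (hb.smul ht) using 1
  obtain rfl : t = 1 - s := by linarith
  ext i j
  fin_cases i <;> fin_cases j <;> simp [hexagonPencil] <;> ring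

/-- A nonnegative multiple of a rank one matrix `u uᴴ` is positive semidefinite. -/
lemma Matrix.PosSemidef.of_eq_smul_vecMulVec {n : Type*} [Fintype n] {A : Matrix n n ℂ} (c : ℝ)
    (hc : 0 ≤ c) (u : n → ℂ) (h : A = c • Matrix.vecMulVec u (star u)) : A.PosSemidef :=
  h ▸ (Matrix.posSemidef_vecMulVec_self_star u).smul hc

lemma exists_hexagonPencil_posSemidef_hexagonVertex (k : Fin 6) :
    ∃ x3 x4 x5 : ℝ,
      (hexagonPencil (hexagonVertex k 0) (hexagonVertex k 1) x3 x4 x5).PosSemidef := by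
  have h3 : (√3 : ℂ) ≠ 0 := by simp
  have hmul : (√3 : ℂ) * √3 = 3 := by
    rw [← Complex.ofReal_mul, Real.mul_self_sqrt (by norm_num)]; norm_num
  have hI := Complex.I_mul_I
  have hconj : (starRingEnd ℂ) 2 = 2 := Complex.conj_ofNat 2
  fin_cases k
  · refine ⟨-1, 0, 0, .of_eq_smul_vecMulVec 2 (by norm_num) ![1, 0, 0] ?_⟩
    ext i j
    fin_cases i <;> fin_cases j <;>
      simp [hexagonPencil, hexagonVertex_zero, Matrix.vecMulVec]
    grind
  · refine ⟨-1, 0, 0, .of_eq_smul_vecMulVec 1 (by norm_num) ![0, 1, 0] ?_⟩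
    ext i j
    fin_cases i <;> fin_cases j <;>
      simp [hexagonPencil, hexagonVertex_one, Matrix.vecMulVec] <;> grind
  · refine ⟨-1, 0, 0, .of_eq_smul_vecMulVec 1 (by norm_num) ![0, 0, 1] ?_⟩
    ext i j
    fin_cases i <;> fin_cases j <;>
      simp [hexagonPencil, hexagonVertex_two, Matrix.vecMulVec] <;> grind
  · refine ⟨1, 0, 0, .of_eq_smul_vecMulVec 2 (by norm_num) ![1, 1, 1] ?_⟩
    ext i j
    fin_cases i <;> fin_cases j <;>
      simp [hexagonPencil, hexagonVertex_three, Matrix.vecMulVec] <;> grind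
  · refine ⟨2, 2, -1, .of_eq_smul_vecMulVec 1 (by norm_num)
      ![2, 2 - Complex.I, 1 - Complex.I] ?_⟩
    ext i j
    fin_cases i <;> fin_cases j <;>
      simp [hexagonPencil, hexagonVertex_four, Matrix.vecMulVec] <;> grind
  · refine ⟨0, 2, -1, .of_eq_smul_vecMulVec 1 (by norm_num)
      ![2, 1 - Complex.I, -Complex.I] ?_⟩
    ext i j
    fin_cases i <;> fin_cases j <;>
      simp [hexagonPencil, hexagonVertex_five, Matrix.vecMulVec] <;> grind

/-- The facet inequalities of the hexagon follow from positive semidefiniteness of the pencil. -/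
lemma facet_inequalities_of_hexagonPencil_posSemidef {p q x3 x4 x5 : ℝ}
    (h : (hexagonPencil p (√3 * q) x3 x4 x5).PosSemidef) :
    |q| ≤ 1 / 2 ∧ |p + q| ≤ 1 ∧ |p - q| ≤ 1 := by
  have hpencil : hexagonPencil p (√3 * q) x3 x4 x5 =
      !![((2 - 4 * q : ℝ) : ℂ), ⟨1 + x3 - x5, x4⟩, ⟨1 + x3 + x5, x4⟩;
        ⟨1 + x3 - x5, -x4⟩, ((1 + p + 3 * q + 2 * x3 - 2 * x5 : ℝ) : ℂ), ⟨1 + x3, -x5⟩;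
        ⟨1 + x3 + x5, -x4⟩, ⟨1 + x3, x5⟩, ((1 - p - q : ℝ) : ℂ)] := by
    ext i j
    fin_cases i <;> fin_cases j <;> simp [hexagonPencil, Complex.ext_iff] <;> grind
  rw [hpencil] at h
  have key (u : Fin 3 → ℂ) := (Complex.nonneg_iff.mp (h.dotProduct_mulVec_nonneg u)).1
  have e12 := key ![1, 0, 0]
  have e01 := key ![0, 0, 1]
  have e23 := key ![1, -1, 0]
  have e34 := key ![-1, 1 - Complex.I, Complex.I]
  have e45 := key ![-1, 2, -2]
  have e50 := key ![0, -Complex.I, 1 + Complex.I]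
  simp [Matrix.mulVec, dotProduct, Fin.sum_univ_three] at e12 e01 e23 e34 e45 e50
  refine ⟨abs_le.mpr ⟨?_, ?_⟩, abs_le.mpr ⟨?_, ?_⟩, abs_le.mpr ⟨?_, ?_⟩⟩ <;> linarith

/-- The upper half of the hexagon, in coordinates where the second axis is rescaled by `√3`. -/
lemma mem_convexHull_range_hexagonVertex_of_nonneg {p q : ℝ} (h0 : 0 ≤ q) (hq : q ≤ 1 / 2)
    (h1 : p + q ≤ 1) (h2 : q - p ≤ 1) :
    ![p, √3 * q] ∈ convexHull ℝ (Set.range hexagonVertex) := by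
  have hv (k : Fin 6) : hexagonVertex k ∈ convexHull ℝ (Set.range hexagonVertex) :=
    subset_convexHull ℝ _ ⟨k, rfl⟩
  have hc := convex_convexHull ℝ (Set.range hexagonVertex)
  have right : (1 - 2 * q) • hexagonVertex 0 + (2 * q) • hexagonVertex 1 ∈ _ :=
    hc (hv 0) (hv 1) (by linarith) (by linarith) (by ring)
  have left : (1 - 2 * q) • hexagonVertex 3 + (2 * q) • hexagonVertex 2 ∈ _ :=
    hc (hv 3) (hv 2) (by linarith) (by linarith) (by ring)
  have hne : 1 - q ≠ 0 := by linarith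
  have hpos : 0 < 2 * (1 - q) := by linarith
  have hmem := hc right left (a := (1 - q + p) / (2 * (1 - q))) (b := (1 - q - p) / (2 * (1 - q)))
    (div_nonneg (by linarith) hpos.le) (div_nonneg (by linarith) hpos.le)
    (by field_simp; ring)
  convert hmem using 1
  ext i
  fin_cases i <;>
    simp [hexagonVertex_zero, hexagonVertex_one, hexagonVertex_two, hexagonVertex_three] <;>
    field_simp <;> ring

lemma neg_mem_convexHull_range_hexagonVertex {v : Fin 2 → ℝ}
    (h : v ∈ convexHull ℝ (Set.range hexagonVertex)) :
    -v ∈ convexHull ℝ (Set.range hexagonVertex) := by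
  have hneg : -Set.range hexagonVertex ⊆ Set.range hexagonVertex := by
    rintro w ⟨k, hk⟩
    rw [← neg_neg w, ← hk]
    fin_cases k
    exacts [⟨3, hexagonVertex_add_three 0 3 rfl⟩, ⟨4, hexagonVertex_add_three 1 4 rfl⟩,
      ⟨5, hexagonVertex_add_three 2 5 rfl⟩, ⟨0, by simp [hexagonVertex_add_three 0 3 rfl]⟩,
      ⟨1, by simp [hexagonVertex_add_three 1 4 rfl]⟩,
      ⟨2, by simp [hexagonVertex_add_three 2 5 rfl]⟩]
  refine convexHull_mono hneg ?_
  rwa [convexHull_neg, Set.neg_mem_neg]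

lemma mem_convexHull_range_hexagonVertex {p q : ℝ} (hq : |q| ≤ 1 / 2) (h1 : |p + q| ≤ 1)
    (h2 : |p - q| ≤ 1) : ![p, √3 * q] ∈ convexHull ℝ (Set.range hexagonVertex) := by
  rw [abs_le] at hq h1 h2
  rcases le_total 0 q with h0 | h0
  · exact mem_convexHull_range_hexagonVertex_of_nonneg h0 hq.2 h1.2 (by linarith)
  · have := neg_mem_convexHull_range_hexagonVertex <|
      mem_convexHull_range_hexagonVertex_of_nonneg (p := -p) (q := -q) (by linarith)
        (by linarith) (by linarith) (by linarith)
    simpa using this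

/-- Explicit complex spectrahedral lift of size 3 of the regular hexagon
(Example after Proposition 3.5): `(x₁, x₂)` lies in the convex hull of the sixth
roots of unity iff the given 3×3 Hermitian pencil is positive semidefinite for some
real `x₃, x₄, x₅`. -/
theorem stmt_13 (x1 x2 : ℝ) :
    ![x1, x2] ∈ convexHull ℝ (Set.range fun k : Fin 6 =>
        ![Real.cos ((k : ℕ) * Real.pi / 3), Real.sin ((k : ℕ) * Real.pi / 3)]) ↔
    ∃ x3 x4 x5 : ℝ,
      (!![2 - 4 / (Real.sqrt 3 : ℂ) * (x2 : ℂ),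
            1 + (x3 : ℂ) + Complex.I * (x4 : ℂ) - (x5 : ℂ),
            1 + (x3 : ℂ) + Complex.I * (x4 : ℂ) + (x5 : ℂ);
          1 + (x3 : ℂ) - Complex.I * (x4 : ℂ) - (x5 : ℂ),
            1 + (x1 : ℂ) + (Real.sqrt 3 : ℂ) * (x2 : ℂ) + 2 * (x3 : ℂ) - 2 * (x5 : ℂ),
            1 + (x3 : ℂ) - Complex.I * (x5 : ℂ);
          1 + (x3 : ℂ) - Complex.I * (x4 : ℂ) + (x5 : ℂ),
            1 + (x3 : ℂ) + Complex.I * (x5 : ℂ),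
            1 - (x1 : ℂ) - 1 / (Real.sqrt 3 : ℂ) * (x2 : ℂ)] :
        Matrix (Fin 3) (Fin 3) ℂ).PosSemidef := by
  change ![x1, x2] ∈ convexHull ℝ (Set.range hexagonVertex) ↔
    ∃ x3 x4 x5 : ℝ, (hexagonPencil x1 x2 x3 x4 x5).PosSemidef
  constructor
  · intro h
    have hsub : Set.range hexagonVertex ⊆ {v : Fin 2 → ℝ | ∃ x3 x4 x5 : ℝ,
        (hexagonPencil (v 0) (v 1) x3 x4 x5).PosSemidef} := by
      rintro _ ⟨k, rfl⟩
      exact exists_hexagonPencil_posSemidef_hexagonVertex k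
    simpa using convexHull_min hsub convex_setOf_exists_hexagonPencil_posSemidef h
  · rintro ⟨x3, x4, x5, h⟩
    obtain ⟨q, rfl⟩ : ∃ q, x2 = √3 * q := ⟨x2 / √3, by field_simp⟩
    obtain ⟨hq, h1, h2⟩ := facet_inequalities_of_hexagonPencil_posSemidef h
    exact mem_convexHull_range_hexagonVertex hq h1 h2
end
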